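/- arXiv:2209.12380 — 4 statements merged into one kernel-verified Lean document; each statement's English description precedes it below -/
import Mathlib

section
/- The collocation-point map is injective: fix an integer p ≥ 1, a dimension N ≥ 1, and real bounds a_i < b_i for i = 1,…,N; if (j, λ, k) and (j′, λ′, k′) are two triples with integer levels j, j′ ≥ 1, types λ, λ′ ∈ {1, …, 2^N − 1}, and k, k′ ∈ ℤ^N such that ϑ(j, λ, k) = ϑ(j′, λ′, k′), then j = j′, λ = λ′, and k = k′. -/
theorem exists_testBit_of_bounds (N lam : ℕ) (h : 1 ≤ lam ∧ lam ≤ 2 ^ N - 1) :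
    ∃ i : Fin N, Nat.testBit lam (i : ℕ) = true := by
  obtain ⟨i, hi⟩ := Nat.exists_testBit_of_ne_zero (x := lam) (by omega)
  refine ⟨⟨i, ?_⟩, hi⟩
  by_contra hc
  have h1 : 2 ^ N ≤ 2 ^ i := Nat.pow_le_pow_right (by norm_num) (by omega)
  have h2 := Nat.ge_two_pow_of_testBit hi
  have h3 : 0 < 2 ^ N := by positivity
  omega

theorem level_le_of_odd (x y : ℤ) (m n : ℕ) (h : x * 2 ^ n = (2 * y + 1) * 2 ^ m) : n ≤ m := by
  by_contra hc
  obtain ⟨d, rfl⟩ : ∃ d, n = m + (d + 1) := ⟨n - m - 1, by omega⟩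
  have h2 : (2 : ℤ) ^ m ≠ 0 := by positivity
  have h3 : x * 2 ^ d * 2 = 2 * y + 1 := by
    apply mul_right_cancel₀ h2
    rw [← h]
    ring
  omega

/-- The collocation-point map `ϑ(j, λ, k)` with coordinates
`x_i = a_i + (2 k_i + bin(λ)_i) (b_i − a_i) / (p · 2^(j+1))` is injective
on levels `j ≥ 1`, types `λ ∈ {1, …, 2^N − 1}`, and indices `k ∈ ℤ^N`. -/
theorem collocation_map_injective
    (p : ℤ) (hp : 1 ≤ p) (N : ℕ) (hN : 1 ≤ N)
    (a b : Fin N → ℝ) (hab : ∀ i, a i < b i)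
    (j j' : ℤ) (hj : 1 ≤ j) (hj' : 1 ≤ j')
    (lam lam' : ℕ)
    (hlam : 1 ≤ lam ∧ lam ≤ 2 ^ N - 1)
    (hlam' : 1 ≤ lam' ∧ lam' ≤ 2 ^ N - 1)
    (k k' : Fin N → ℤ)
    (heq : ∀ i : Fin N,
      a i + (2 * (k i : ℝ) + (if Nat.testBit lam (i : ℕ) then 1 else 0)) * (b i - a i)
          / ((p : ℝ) * 2 ^ (j + 1))
        = a i + (2 * (k' i : ℝ) + (if Nat.testBit lam' (i : ℕ) then 1 else 0)) * (b i - a i)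
          / ((p : ℝ) * 2 ^ (j' + 1))) :
    j = j' ∧ lam = lam' ∧ k = k' := by
  lift j to ℕ using by omega
  lift j' to ℕ using by omega
  have key : ∀ i : Fin N,
      (2 * k i + (if Nat.testBit lam (i : ℕ) then 1 else 0)) * 2 ^ j'
        = (2 * k' i + (if Nat.testBit lam' (i : ℕ) then 1 else 0)) * 2 ^ j := by
    intro i
    have h := add_left_cancel (heq i)
    have hp' : (p : ℝ) ≠ 0 := by
      have : p ≠ 0 := by omega
      exact_mod_cast this
    have hb : b i - a i ≠ 0 := sub_ne_zero.mpr (hab i).ne'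
    have e1 : (2 : ℝ) ^ ((j : ℤ) + 1) = 2 ^ j * 2 := by
      rw [zpow_add₀ (by norm_num)]; simp
    have e2 : (2 : ℝ) ^ ((j' : ℤ) + 1) = 2 ^ j' * 2 := by
      rw [zpow_add₀ (by norm_num)]; simp
    rw [e1, e2, div_eq_div_iff (by positivity) (by positivity)] at h
    have hc : (b i - a i) * (p * 2) ≠ 0 := mul_ne_zero hb (mul_ne_zero hp' (by norm_num))
    have h2 : (2 * (k i : ℝ) + (if Nat.testBit lam (i : ℕ) then 1 else 0)) * 2 ^ j'
        = (2 * (k' i : ℝ) + (if Nat.testBit lam' (i : ℕ) then 1 else 0)) * 2 ^ j := by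
      apply mul_right_cancel₀ hc
      linear_combination h
    exact_mod_cast h2
  have hjj : j = j' := by
    apply le_antisymm
    · obtain ⟨i, hi⟩ := exists_testBit_of_bounds N lam hlam
      have h := key i
      rw [if_pos hi] at h
      exact level_le_of_odd _ _ _ _ h.symm
    · obtain ⟨i, hi⟩ := exists_testBit_of_bounds N lam' hlam'
      have h := key i
      rw [if_pos hi] at h
      exact level_le_of_odd _ _ _ _ h
  subst hjj
  have key2 : ∀ i : Fin N, Nat.testBit lam (i : ℕ) = Nat.testBit lam' (i : ℕ) ∧ k i = k' i := by
    intro i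
    have h := mul_right_cancel₀ (by positivity) (key i)
    cases h1 : Nat.testBit lam (i : ℕ) <;> cases h2 : Nat.testBit lam' (i : ℕ) <;>
      simp [h1, h2] at h ⊢ <;> omega
  refine ⟨rfl, ?_, funext fun i => (key2 i).2⟩
  apply Nat.eq_of_testBit_eq
  intro i
  by_cases hi : i < N
  · exact (key2 ⟨i, hi⟩).1
  · have h3 : 2 ^ N ≤ 2 ^ i := Nat.pow_le_pow_right (by norm_num) (by omega)
    have h4 : 0 < 2 ^ N := by positivity
    rw [Nat.testBit_lt_two_pow (by omega), Nat.testBit_lt_two_pow (by omega)]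
end

section
/- The inverse collocation-map formulas are correct: let j ≥ 1 be an integer level, λ ∈ {1, …, 2^N − 1} a type, k ∈ ℤ^N, and x = ϑ(j, λ, k). For each i let R_i = { r ∈ ℤ : r ≥ 1 and (x_i − a_i) · p · 2^{r+1} / (b_i − a_i) ∈ ℤ }; then each R_i is nonempty, and one recovers: (i) j = max_{1 ≤ i ≤ N} (min R_i); (ii) bin(λ)_i = ((x_i − a_i) · p · 2^{j+1} / (b_i − a_i)) mod 2 for each i; and (iii) k_i = (x_i − a_i) · p · 2^{j} / (b_i − a_i) − bin(λ)_i / 2 for each i. -/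
/-- Correctness of the inverse collocation-map formulas: if
`x = ϑ(j, λ, k)` with `x_i = a_i + (2 k_i + bin(λ)_i)(b_i − a_i)/(p · 2^(j+1))`,
and `R_i = { r ∈ ℤ : r ≥ 1 ∧ (x_i − a_i) p 2^(r+1)/(b_i − a_i) ∈ ℤ }`, then each
`R_i` is nonempty, `j = max_i (min R_i)`,
`bin(λ)_i = ((x_i − a_i) p 2^(j+1)/(b_i − a_i)) mod 2`, and
`k_i = (x_i − a_i) p 2^j/(b_i − a_i) − bin(λ)_i / 2`. -/
theorem collocation_map_inverse
    (p : ℤ) (hp : 1 ≤ p) (N : ℕ) (hN : 1 ≤ N)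
    (a b : Fin N → ℝ) (hab : ∀ i, a i < b i)
    (j : ℤ) (hj : 1 ≤ j)
    (lam : ℕ) (hlam : 1 ≤ lam ∧ lam ≤ 2 ^ N - 1)
    (k : Fin N → ℤ) (x : Fin N → ℝ)
    (hx : ∀ i : Fin N,
      x i = a i + (2 * (k i : ℝ) + (if Nat.testBit lam (i : ℕ) then 1 else 0)) * (b i - a i)
          / ((p : ℝ) * 2 ^ (j + 1))) :
    (∀ i : Fin N,
      ({r : ℤ | 1 ≤ r ∧ ∃ z : ℤ,
        (x i - a i) * (p : ℝ) * 2 ^ (r + 1) / (b i - a i) = (z : ℝ)}).Nonempty) ∧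
    (∀ m : Fin N → ℤ,
      (∀ i : Fin N, IsLeast
        {r : ℤ | 1 ≤ r ∧ ∃ z : ℤ,
          (x i - a i) * (p : ℝ) * 2 ^ (r + 1) / (b i - a i) = (z : ℝ)} (m i)) →
      j = Finset.univ.sup' (Finset.univ_nonempty_iff.mpr ⟨⟨0, hN⟩⟩) m) ∧
    (∀ i : Fin N, ∃ e : ℤ,
      (e : ℝ) = (x i - a i) * (p : ℝ) * 2 ^ (j + 1) / (b i - a i) ∧
      (if Nat.testBit lam (i : ℕ) then (1 : ℤ) else 0) = e % 2 ∧
      (k i : ℝ) = (x i - a i) * (p : ℝ) * 2 ^ j / (b i - a i)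
          - (if Nat.testBit lam (i : ℕ) then (1 : ℝ) else 0) / 2) := by
  have hp0 : (p : ℝ) ≠ 0 := by
    have : p ≠ 0 := by omega
    exact_mod_cast this
  have key : ∀ (i : Fin N) (r : ℤ), (x i - a i) * (p : ℝ) * 2 ^ r / (b i - a i)
      = (((2 * k i + (if Nat.testBit lam (i : ℕ) then 1 else 0) : ℤ)) : ℝ)
        * 2 ^ (r - (j + 1)) := by
    intro i r
    have hb : b i - a i ≠ 0 := (sub_pos.mpr (hab i)).ne'
    have h2 : (2 : ℝ) ^ (j + 1) ≠ 0 := zpow_ne_zero _ two_ne_zero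
    rw [hx i, zpow_sub₀ (two_ne_zero : (2 : ℝ) ≠ 0)]
    generalize (2 : ℝ) ^ (j + 1) = t at *
    push_cast
    field_simp
    ring
  have keyj : ∀ (i : Fin N), (x i - a i) * (p : ℝ) * 2 ^ (j + 1) / (b i - a i)
      = (((2 * k i + (if Nat.testBit lam (i : ℕ) then 1 else 0) : ℤ)) : ℝ) := by
    intro i
    rw [key, sub_self, zpow_zero, mul_one]
  refine ⟨fun i => ⟨j, hj, _, keyj i⟩, ?_, ?_⟩
  · intro m hm
    apply le_antisymm
    · obtain ⟨n, hn⟩ := Nat.exists_testBit_of_ne_zero (x := lam) (by omega)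
      have hnN : n < N := by
        by_contra hcon
        have h1 := Nat.ge_two_pow_of_testBit hn
        have h2 : 2 ^ N ≤ 2 ^ n := Nat.pow_le_pow_right (by norm_num) (by omega)
        have h3 : 0 < 2 ^ N := by positivity
        omega
      refine le_trans ?_ (Finset.le_sup' m (Finset.mem_univ (⟨n, hnN⟩ : Fin N)))
      by_contra hlt
      push Not at hlt
      obtain ⟨-, z, hz⟩ := (hm ⟨n, hnN⟩).1
      rw [key] at hz
      simp only [hn, if_true] at hz
      generalize m ⟨n, hnN⟩ = r at *
      generalize k ⟨n, hnN⟩ = q at *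
      obtain ⟨d, hd⟩ : ∃ d : ℕ, j = r + 1 + d := ⟨(j - r - 1).toNat, by omega⟩
      have e : r + 1 - (j + 1) = -((d + 1 : ℕ) : ℤ) := by push_cast; omega
      rw [e, zpow_neg, zpow_natCast, ← div_eq_mul_inv, div_eq_iff (by positivity)] at hz
      have hz' : 2 * q + 1 = z * 2 ^ (d + 1) := by exact_mod_cast hz
      rw [pow_succ, ← mul_assoc] at hz'
      omega
    · refine Finset.sup'_le _ _ fun i _ => (hm i).2 ⟨hj, _, keyj i⟩
  · intro i
    refine ⟨_, (keyj i).symm, ?_, ?_⟩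
    · split_ifs <;> omega
    · rw [key, show j - (j + 1) = -1 by ring, zpow_neg_one]
      push_cast
      ring
end

section
/- Derivation of the damaged Cauchy stress (Eq. 28 of the paper): fix κ, μ ∈ ℝ, ω ∈ ℝ, and a 3×3 real symmetric positive-definite matrix b; set J := √(det b), and on the open set of 3×3 matrices with positive determinant define W(A) = (1 − ω)[ (κ/2)(e^{√(det A)−1} − ln √(det A) − 1) + (μ/2)((det A)^{−1/3} tr(A) − 3) ]. Then W is Fréchet differentiable at b with derivative H ↦ tr(Sᵀ H), where S = (1 − ω)[ (κ/4)(J e^{J−1} − 1) b⁻¹ + (μ/2) J^{−2/3} ( I − (tr(b)/3) b⁻¹ ) ], and consequently (2/J) · S · b = (1 − ω)[ (κ/2)(e^{J−1} − 1/J) I + μ J^{−5/3} (b − (tr(b)/3) I) ]. -/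
open Matrix

attribute [local instance] Matrix.normedAddCommGroup Matrix.normedSpace

/-- `d` is Fréchet differentiable at `b` with derivative `H ↦ G H`. -/
def HasD {E : Type*} [NormedAddCommGroup E] [NormedSpace ℝ E] (d G : E → ℝ) (b : E) : Prop :=
  ∃ g : E →L[ℝ] ℝ, HasFDerivAt d g b ∧ ∀ H, g H = G H

lemma HasD.of_linear {E : Type*} [NormedAddCommGroup E] [NormedSpace ℝ E] [FiniteDimensional ℝ E]
    (l : E →ₗ[ℝ] ℝ) (b : E) : HasD (fun A => l A) (fun A => l A) b :=
  ⟨LinearMap.toContinuousLinearMap l, (LinearMap.toContinuousLinearMap l).hasFDerivAt,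
    fun _ => rfl⟩

/-- Abstract derivative of the 3×3 determinant polynomial in nine functions. -/
lemma det_poly_abs {E : Type*} [NormedAddCommGroup E] [NormedSpace ℝ E]
    (a G : Fin 3 → Fin 3 → E → ℝ) (b : E)
    (hD : ∀ i j, HasD (a i j) (G i j) b) :
    HasD (fun A => (Matrix.of fun i j => a i j A).det)
      (fun H => ((Matrix.of fun i j => a i j b).adjugate *
        (Matrix.of fun i j => G i j H)).trace) b := by
  choose l e hl using hD
  have h := ((((((((e 0 0).mul (e 1 1)).mul (e 2 2)).sub
    (((e 0 0).mul (e 1 2)).mul (e 2 1))).sub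
    (((e 0 1).mul (e 1 0)).mul (e 2 2))).add
    (((e 0 1).mul (e 1 2)).mul (e 2 0))).add
    (((e 0 2).mul (e 1 0)).mul (e 2 1))).sub
    (((e 0 2).mul (e 1 1)).mul (e 2 0)))
  refine ⟨_, h.congr_of_eventuallyEq (Filter.Eventually.of_forall fun A => ?_), fun H => ?_⟩
  · simp [Matrix.det_fin_three]
  · beta_reduce
    rw [Matrix.adjugate_fin_three, Matrix.trace_fin_three]
    simp only [Matrix.mul_apply, Fin.sum_univ_three, Matrix.of_apply, ← hl]
    simp
    ring

lemma hasD_trace3 (b : Matrix (Fin 3) (Fin 3) ℝ) :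
    HasD (fun A : Matrix (Fin 3) (Fin 3) ℝ => A.trace) (fun A => A.trace) b :=
  HasD.of_linear (Matrix.traceLinearMap (Fin 3) ℝ ℝ) b

lemma hasD_entry (b : Matrix (Fin 3) (Fin 3) ℝ) (i j : Fin 3) :
    HasD (fun A : Matrix (Fin 3) (Fin 3) ℝ => A i j) (fun A => A i j) b :=
  HasD.of_linear (Matrix.entryLinearMap ℝ ℝ i j) b

lemma hasD_det3 (b : Matrix (Fin 3) (Fin 3) ℝ) :
    HasD (fun A : Matrix (Fin 3) (Fin 3) ℝ => A.det) (fun H => (b.adjugate * H).trace) b :=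
  det_poly_abs (E := Matrix (Fin 3) (Fin 3) ℝ) (fun i j A => A i j) (fun i j A => A i j) b
    (hasD_entry b)

/-- Chain rule for the energy, over an abstract normed space. -/
lemma energy_abs {E : Type*} [NormedAddCommGroup E] [NormedSpace ℝ E]
    (κ μ ω : ℝ) (d t G T : E → ℝ) (b : E) (hd : 0 < d b)
    (hdG : HasD d G b) (htT : HasD t T b) :
    HasD (fun A =>
        (1 - ω) * (κ / 2 * (Real.exp (Real.sqrt (d A) - 1)
            - Real.log (Real.sqrt (d A)) - 1)
          + μ / 2 * (d A ^ (-(1 : ℝ) / 3) * t A - 3)))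
      (fun H => (1 - ω) * (κ / 2 * ((Real.exp (Real.sqrt (d b) - 1) - (Real.sqrt (d b))⁻¹)
          * (1 / (2 * Real.sqrt (d b)) * G H))
        + μ / 2 * (d b ^ (-(1 : ℝ) / 3) * T H
          + t b * (-(1 : ℝ) / 3 * d b ^ (-(1 : ℝ) / 3 - 1) * G H)))) b := by
  obtain ⟨g, hg, hgG⟩ := hdG
  obtain ⟨τ, ht, hτ⟩ := htT
  have hsq := hg.sqrt hd.ne'
  have hsn : Real.sqrt (d b) ≠ 0 := (Real.sqrt_pos.mpr hd).ne'
  have h1 := ((hsq.sub_const 1).exp.sub (hsq.log hsn)).sub_const 1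
  have hp := (hg.rpow_const (p := -(1 : ℝ) / 3) (Or.inl hd.ne')).mul ht
  have h2 := ((h1.const_mul (κ / 2)).add ((hp.sub_const 3).const_mul (μ / 2))).const_mul (1 - ω)
  refine ⟨_, h2, fun H => ?_⟩
  simp only [_root_.smul_apply, _root_.add_apply, _root_.sub_apply, smul_eq_mul, hgG, hτ]
  ring

/-- Derivation of the damaged Cauchy stress: for `b` symmetric positive
definite with `J = √(det b)`, the strain energy
`W(A) = (1 − ω)[(κ/2)(e^{√(det A)−1} − ln √(det A) − 1)
  + (μ/2)((det A)^{−1/3} tr A − 3)]`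
is Fréchet differentiable at `b` with derivative `H ↦ tr(Sᵀ H)`, where
`S = (1 − ω)[(κ/4)(J e^{J−1} − 1) b⁻¹ + (μ/2) J^{−2/3}(I − (tr b/3) b⁻¹)]`,
and consequently
`(2/J) S b = (1 − ω)[(κ/2)(e^{J−1} − 1/J) I + μ J^{−5/3}(b − (tr b/3) I)]`. -/
theorem damaged_cauchy_stress
    (κ μ ω : ℝ) (b : Matrix (Fin 3) (Fin 3) ℝ) (hb : b.PosDef)
    (J : ℝ) (hJ : J = Real.sqrt b.det)
    (S : Matrix (Fin 3) (Fin 3) ℝ)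
    (hS : S = (1 - ω) • ((κ / 4 * (J * Real.exp (J - 1) - 1)) • b⁻¹
      + (μ / 2 * J ^ (-(2 : ℝ) / 3)) • ((1 : Matrix (Fin 3) (Fin 3) ℝ)
        - (b.trace / 3) • b⁻¹))) :
    (∃ f : Matrix (Fin 3) (Fin 3) ℝ →L[ℝ] ℝ,
      HasFDerivAt (fun A : Matrix (Fin 3) (Fin 3) ℝ =>
        (1 - ω) * (κ / 2 * (Real.exp (Real.sqrt A.det - 1)
            - Real.log (Real.sqrt A.det) - 1)
          + μ / 2 * (A.det ^ (-(1 : ℝ) / 3) * A.trace - 3))) f b ∧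
      ∀ H : Matrix (Fin 3) (Fin 3) ℝ, f H = (Sᵀ * H).trace) ∧
    (2 / J) • (S * b)
      = (1 - ω) • ((κ / 2 * (Real.exp (J - 1) - 1 / J))
            • (1 : Matrix (Fin 3) (Fin 3) ℝ)
          + (μ * J ^ (-(5 : ℝ) / 3)) • (b - (b.trace / 3)
            • (1 : Matrix (Fin 3) (Fin 3) ℝ))) := by
  have hd : 0 < b.det := hb.det_pos
  have hJ0 : 0 < J := by rw [hJ]; exact Real.sqrt_pos.mpr hd
  have hJ2 : b.det = J ^ 2 := by rw [hJ, Real.sq_sqrt hd.le]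
  have hu : IsUnit b.det := hd.ne'.isUnit
  have hsymm : bᵀ = b := by
    have := hb.isHermitian.eq
    rwa [Matrix.conjTranspose_eq_transpose_of_trivial] at this
  constructor
  · obtain ⟨f, hf, hfH⟩ := energy_abs κ μ ω _ _ _ _ b hd (hasD_det3 b) (hasD_trace3 b)
    refine ⟨f, hf, fun H => ?_⟩
    refine (hfH H).trans ?_
    have hgT : (b.adjugate * H).trace = J ^ 2 * (b⁻¹ * H).trace := by
      rw [← hJ2, Matrix.inv_def, Matrix.smul_mul, Matrix.trace_smul, smul_eq_mul,
        Ring.inverse_eq_inv', mul_inv_cancel_left₀ hd.ne']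
    have hp1 : b.det ^ (-(1 : ℝ) / 3) = J ^ (-(2 : ℝ) / 3) := by
      rw [hJ2, ← Real.rpow_natCast, ← Real.rpow_mul hJ0.le]; norm_num
    have hp2 : b.det ^ (-(1 : ℝ) / 3 - 1) = J ^ (-(2 : ℝ) / 3) / J ^ 2 := by
      rw [Real.rpow_sub_one hd.ne', hp1, hJ2]
    have hST : Sᵀ = S := by
      rw [hS]; simp [Matrix.transpose_nonsing_inv, hsymm]
    beta_reduce
    rw [hST, hS, hgT, hp1, hp2, ← hJ]
    simp only [smul_eq_mul,
      Matrix.smul_mul, Matrix.add_mul, Matrix.sub_mul, Matrix.one_mul,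
      Matrix.trace_smul, Matrix.trace_add, Matrix.trace_sub]
    field_simp
    ring
  · have hp : J ^ (-(5 : ℝ) / 3) = J ^ (-(2 : ℝ) / 3) / J := by
      rw [← Real.rpow_sub_one hJ0.ne']; norm_num
    rw [hS, hp]
    simp only [Matrix.smul_mul, Matrix.add_mul, Matrix.sub_mul, Matrix.one_mul,
      Matrix.nonsing_inv_mul b hu]
    ext i j
    simp only [Matrix.smul_apply, Matrix.add_apply, Matrix.sub_apply, smul_eq_mul]
    field_simp
    ring
end

section
/- Nonnegativity of the strain energy, the damage energy release rate, and the damage dissipation: let κ ≥ 0, μ ≥ 0, ω ∈ [0, 1], and let b be a 3×3 real symmetric positive-definite matrix with J := √(det b). Then W(ω, b) = (1 − ω)[ (κ/2)(e^{J−1} − ln J − 1) + (μ/2)(J^{−2/3} tr(b) − 3) ] ≥ 0, the damage energy release rate Y := (1/J)[ (κ/2)(e^{J−1} − ln J − 1) + (μ/2)(J^{−2/3} tr(b) − 3) ] ≥ 0, and for any μ_ω ≥ 0 and any reals G, χ, the damage dissipation D_ω = Y · μ_ω · max(G − χ, 0) ≥ 0. -/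
open Matrix

/-- Nonnegativity of the strain energy, the damage energy release rate, and
the damage dissipation: for `κ ≥ 0`, `μ ≥ 0`, `ω ∈ [0,1]`, and a `3×3`
symmetric positive-definite `b` with `J = √(det b)`, one has
`W(ω, b) = (1 − ω)[(κ/2)(e^{J−1} − ln J − 1) + (μ/2)(J^{−2/3} tr b − 3)] ≥ 0`,
`Y = (1/J)[(κ/2)(e^{J−1} − ln J − 1) + (μ/2)(J^{−2/3} tr b − 3)] ≥ 0`, and the
damage dissipation `D_ω = Y μ_ω ⟨G − χ⟩ ≥ 0` for any `μ_ω ≥ 0`, `G, χ ∈ ℝ`. -/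
theorem strain_energy_release_dissipation_nonneg
    (κ μ ω : ℝ) (hκ : 0 ≤ κ) (hμ : 0 ≤ μ) (hω0 : 0 ≤ ω) (hω1 : ω ≤ 1)
    (b : Matrix (Fin 3) (Fin 3) ℝ) (hb : b.PosDef)
    (J : ℝ) (hJ : J = Real.sqrt b.det)
    (W Y : ℝ)
    (hW : W = (1 - ω) * (κ / 2 * (Real.exp (J - 1) - Real.log J - 1)
      + μ / 2 * (J ^ (-(2 : ℝ) / 3) * b.trace - 3)))
    (hY : Y = (1 / J) * (κ / 2 * (Real.exp (J - 1) - Real.log J - 1)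
      + μ / 2 * (J ^ (-(2 : ℝ) / 3) * b.trace - 3)))
    (μω : ℝ) (hμω : 0 ≤ μω) (G χ : ℝ) :
    0 ≤ W ∧ 0 ≤ Y ∧ 0 ≤ Y * (μω * max (G - χ) 0) := by
  have hdet : 0 < b.det := hb.det_pos
  have hJpos : 0 < J := by rw [hJ]; exact Real.sqrt_pos.mpr hdet
  have h1 : 0 ≤ Real.exp (J - 1) - Real.log J - 1 := by
    have e1 := Real.add_one_le_exp (J - 1)
    have e2 := Real.log_le_sub_one_of_pos hJpos
    linarith
  have h2 : 0 ≤ J ^ (-(2 : ℝ) / 3) * b.trace - 3 := by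
    have ht := hb.1.trace_eq_sum_eigenvalues
    have hd := hb.1.det_eq_prod_eigenvalues
    have p := hb.eigenvalues_pos
    simp only [Fin.sum_univ_three, Fin.prod_univ_three, RCLike.ofReal_real_eq_id, id] at ht hd
    have am := Real.geom_mean_le_arith_mean3_weighted
      (w₁ := 1 / 3) (w₂ := 1 / 3) (w₃ := 1 / 3)
      (by norm_num) (by norm_num) (by norm_num) (p 0).le (p 1).le (p 2).le (by norm_num)
    rw [← Real.mul_rpow (p 0).le (p 1).le,
      ← Real.mul_rpow (mul_pos (p 0) (p 1)).le (p 2).le, ← hd] at am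
    have hJ2 : J ^ (-(2 : ℝ) / 3) = (b.det ^ ((1 : ℝ) / 3))⁻¹ := by
      rw [hJ, Real.sqrt_eq_rpow, ← Real.rpow_mul hdet.le, ← Real.rpow_neg hdet.le]
      norm_num
    have hq : 0 < b.det ^ ((1 : ℝ) / 3) := Real.rpow_pos_of_pos hdet _
    rw [hJ2, sub_nonneg, inv_mul_eq_div, le_div_iff₀ hq]
    linarith
  have hE : 0 ≤ κ / 2 * (Real.exp (J - 1) - Real.log J - 1)
      + μ / 2 * (J ^ (-(2 : ℝ) / 3) * b.trace - 3) := by positivity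
  have hY0 : 0 ≤ Y := by rw [hY]; exact mul_nonneg (by positivity) hE
  refine ⟨?_, hY0, mul_nonneg hY0 (mul_nonneg hμω (le_max_right _ _))⟩
  rw [hW]
  exact mul_nonneg (by linarith) hE
end
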